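/- arXiv:2106.13157 — 2 statements merged into one kernel-verified Lean document; each statement's English description precedes it below -/
import Mathlib

section
/- For every integer k ≥ 1 and every 0 ≤ r ≤ k−1, the continuant polynomials satisfy α(k−1,k)·β(r+1,k) − α(r,k)·β(k,k) = (−1)^{r+1}·y_k·y_1⋯y_r·α_{r+1}(k−r−2,k) in ℤ[x_1,…,x_k,y_1,…,y_k]. -/
noncomputable section

/-- The polynomial ring `ℤ[x_1,…,x_k,y_1,…,y_k]` with indices extended
periodically (`x_{i+k} = x_i`, `y_{i+k} = y_i`), realized by indexing the
two families of variables by `ZMod k`. -/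
abbrev ContRing (k : ℕ) := MvPolynomial (ZMod k ⊕ ZMod k) ℤ

/-- The variable `x_i` (indices taken modulo `k`). -/
def Xv (k : ℕ) (i : ℕ) : ContRing k := MvPolynomial.X (Sum.inl (i : ZMod k))

/-- The variable `y_i` (indices taken modulo `k`). -/
def Yv (k : ℕ) (i : ℕ) : ContRing k := MvPolynomial.X (Sum.inr (i : ZMod k))

/-- `C2 S m` is the collection of `m`-element subsets `{i_1<⋯<i_m}` of `S`
satisfying `i_{j+1} − i_j ≥ 2` for all `j`. -/
def C2 (S : Finset ℕ) (m : ℕ) : Finset (Finset ℕ) :=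
  (Finset.powersetCard m S).filter fun I => ∀ i ∈ I, ∀ j ∈ I, i < j → i + 2 ≤ j

/-- The monomial `p(I)`: obtained from `x_1 x_2 ⋯ x_r` by replacing, for each
`i ∈ I`, the adjacent pair `x_i x_{i+1}` by `y_i`. -/
def pMono (k r : ℕ) (I : Finset ℕ) : ContRing k :=
  (∏ i ∈ I, Yv k i) *
    ∏ j ∈ (Finset.Icc 1 r).filter (fun j => j ∉ I ∧ j - 1 ∉ I), Xv k j

/-- The monomial `q(I)`: obtained from `y_k · x_2 x_3 ⋯ x_{r−1}` by replacing,
for each `i ∈ I`, the adjacent pair `x_i x_{i+1}` by `y_i`. -/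
def qMono (k r : ℕ) (I : Finset ℕ) : ContRing k :=
  Yv k k * (∏ i ∈ I, Yv k i) *
    ∏ j ∈ (Finset.Icc 2 (r - 1)).filter (fun j => j ∉ I ∧ j - 1 ∉ I), Xv k j

/-- The continuant polynomial of type `α` (combinatorial definition):
`α(r,k) = Σ_{m=0}^{⌊r/2⌋} Σ_{I ∈ C₂({1,…,r−1},m)} p(I)`. -/
def alphaComb (k r : ℕ) : ContRing k :=
  ∑ m ∈ Finset.range (r / 2 + 1), ∑ I ∈ C2 (Finset.Icc 1 (r - 1)) m, pMono k r I

/-- The continuant polynomial of type `α`, extended to all `n` by the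
recurrence `α(n,k) = x_n·α(n−1,k) + y_{n−1}·α(n−2,k)` for `n > k`. -/
def alphaN (k : ℕ) (n : ℕ) : ContRing k :=
  if h : n ≤ k then alphaComb k n
  else Xv k n * alphaN k (n - 1) + Yv k (n - 1) * alphaN k (n - 2)
termination_by n
decreasing_by all_goals omega

/-- The continuant polynomial of type `α` with an integer argument,
so that `α(−1,k) = 0`. -/
def alphaZ (k : ℕ) (r : ℤ) : ContRing k :=
  if r < 0 then 0 else alphaN k r.toNat

/-- The continuant polynomial of type `β`:
`β(r,k) = Σ_{m=0}^{⌊(r−2)/2⌋} Σ_{I ∈ C₂({2,…,r−2},m)} q(I)`, with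
`β(0,k) = β(1,k) = 0`. -/
def betaP (k : ℕ) : ℕ → ContRing k
  | 0 => 0
  | 1 => 0
  | r + 2 => ∑ m ∈ Finset.range (r / 2 + 1), ∑ I ∈ C2 (Finset.Icc 2 r) m, qMono k (r + 2) I

/-- The continuant polynomial of type `π`: `π(r,k) = α(r,k) + β(r,k)`. -/
def piP (k r : ℕ) : ContRing k := alphaN k r + betaP k r

/-- The shift by `s`: the ring automorphism of `ℤ[x_1,…,x_k,y_1,…,y_k]`
sending `x_i ↦ x_{i+s}` and `y_i ↦ y_{i+s}` (indices modulo `k`). -/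
def shiftP (k s : ℕ) : ContRing k →ₐ[ℤ] ContRing k :=
  MvPolynomial.rename (Sum.map (· + (s : ZMod k)) (· + (s : ZMod k)))

/-- The generalized Fibonacci polynomial of order `m`, evaluated at `x, y`:
`U_m(x,y) = Σ_{i=0}^{⌊(m−1)/2⌋} (−1)^i · C(m−1−i, i) · x^{m−1−2i} · y^i`,
with `U_0 = 0`. -/
def genFib {K : Type*} [CommRing K] (x y : K) : ℕ → K
  | 0 => 0
  | m + 1 => ∑ i ∈ Finset.range (m / 2 + 1),
      (-1 : K) ^ i * (Nat.choose (m - i) i : K) * x ^ (m - 2 * i) * y ^ i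

/-- The tridiagonal `k`-Toeplitz matrix `T^k_n(ā,b̄,c̄)`: the `n×n` matrix whose
`(i,i)` entry is `a_i`, `(i,i+1)` entry is `b_i`, `(i+1,i)` entry is `c_i`
(1-based indices, extended periodically modulo `k`), and all other entries `0`. -/
def triToeplitz {K : Type*} [CommRing K] (k n : ℕ) (a b c : ZMod k → K) :
    Matrix (Fin n) (Fin n) K :=
  Matrix.of fun i j =>
    if (i : ℕ) = (j : ℕ) then a (((i : ℕ) + 1 : ℕ) : ZMod k)
    else if (j : ℕ) = (i : ℕ) + 1 then b (((i : ℕ) + 1 : ℕ) : ZMod k)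
    else if (i : ℕ) = (j : ℕ) + 1 then c (((j : ℕ) + 1 : ℕ) : ZMod k)
    else 0

/-- The universal determinant `D^{ā,d̄}(n,k)`: the determinant of the `n×n`
tridiagonal matrix with main diagonal generated periodically by `ā`, all
upper-diagonal entries `1`, and lower diagonal generated periodically by `d̄`. -/
def univDet {K : Type*} [CommRing K] (k : ℕ) (a d : ZMod k → K) (n : ℕ) : K :=
  (triToeplitz k n a (fun _ => 1) d).det

/-- The universal determinant with an integer size argument, so that
`D^{ā,d̄}(−1,k) = 0` (and `D^{ā,d̄}(0,k) = 1`). -/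
def univDetZ {K : Type*} [CommRing K] (k : ℕ) (a d : ZMod k → K) (n : ℤ) : K :=
  if n < 0 then 0 else univDet k a d n.toNat

/-- The cyclic shift `σ_s` of a periodic vector by `s` places to the left:
`(σ_s a)_i = a_{i+s}`. -/
def shiftVec {K : Type*} {k : ℕ} (s : ℕ) (a : ZMod k → K) : ZMod k → K :=
  fun i => a (i + (s : ZMod k))


section Continuant

variable {R : Type*} [CommRing R]

/-- The continuant of the `n` variables `x_{s+1},…,x_{s+n}` with linking weights
`y_{s+1},…,y_{s+n-1}`, defined by its three-term recurrence. -/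
def continuant (x y : ℕ → R) (s : ℕ) : ℕ → R
  | 0 => 1
  | 1 => x (s + 1)
  | n + 2 => x (s + n + 2) * continuant x y s (n + 1) + y (s + n + 1) * continuant x y s n

/-- A set of naturals without two consecutive elements. -/
def Sparse (I : Finset ℕ) : Prop := ∀ i ∈ I, ∀ j ∈ I, i < j → i + 2 ≤ j

instance (I : Finset ℕ) : Decidable (Sparse I) := by unfold Sparse; infer_instance

theorem sparse_empty : Sparse ∅ := by simp [Sparse]

/-- The monomial obtained from `x_{s+1} ⋯ x_{s+n}` by replacing `x_i x_{i+1}` by `y_i`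
for `i ∈ I`. -/
def pairMono (x y : ℕ → R) (s n : ℕ) (I : Finset ℕ) : R :=
  (∏ i ∈ I, y i) * ∏ j ∈ (Finset.Icc (s + 1) (s + n)).filter (fun j => j ∉ I ∧ j - 1 ∉ I), x j

theorem pairMono_succ (x y : ℕ → R) {s n : ℕ} {I : Finset ℕ}
    (hI : I ⊆ Finset.Icc (s + 1) (s + n)) :
    pairMono x y s (n + 2) I = x (s + n + 2) * pairMono x y s (n + 1) I := by
  have h₁ : s + n + 1 ∉ I := fun h => by have := Finset.mem_Icc.1 (hI h); omega
  have h₂ : s + n + 1 + 1 ∉ I := fun h => by have := Finset.mem_Icc.1 (hI h); omega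
  simp only [pairMono, Finset.prod_filter]
  rw [show s + (n + 2) = s + n + 1 + 1 by ring, Finset.prod_Icc_succ_top (by omega)]
  simp only [Nat.add_sub_cancel, h₁, h₂, not_false_eq_true, and_self, if_true, ← add_assoc]
  ring

theorem pairMono_insert (x y : ℕ → R) {s n : ℕ} {I : Finset ℕ}
    (hI : I ⊆ Finset.Icc (s + 1) (s + n - 1)) :
    pairMono x y s (n + 2) (insert (s + n + 1) I) = y (s + n + 1) * pairMono x y s n I := by
  have h₁ : s + n + 1 ∉ I := fun h => by have := Finset.mem_Icc.1 (hI h); omega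
  simp only [pairMono]
  rw [Finset.prod_insert h₁, mul_assoc]
  congr 3
  ext j
  have h₂ : j - 1 = s + n + 1 → j = s + n + 2 := by omega
  have h₃ : j = s + n + 2 → j - 1 = s + n + 1 := by omega
  simp only [Finset.mem_filter, Finset.mem_Icc, Finset.mem_insert, not_or]
  constructor
  · rintro ⟨h, ⟨h4, h5⟩, h6, h7⟩
    exact ⟨by omega, h5, h7⟩
  · rintro ⟨h, h5, h7⟩
    exact ⟨by omega, ⟨by omega, h5⟩, by omega, h7⟩

theorem sparse_insert_iff {s n : ℕ} {I : Finset ℕ} (hI : I ⊆ Finset.Icc (s + 1) (s + n - 1)) :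
    Sparse (insert (s + n + 1) I) ↔ Sparse I := by
  refine ⟨fun h i hi j hj => h i (Finset.mem_insert_of_mem hi) j (Finset.mem_insert_of_mem hj),
    fun h i hi j hj hij => ?_⟩
  rcases Finset.mem_insert.1 hi with rfl | hi' <;> rcases Finset.mem_insert.1 hj with rfl | hj'
  · omega
  · have := Finset.mem_Icc.1 (hI hj'); omega
  · have := Finset.mem_Icc.1 (hI hi'); omega
  · exact h i hi' j hj' hij

theorem not_sparse_insert {s n : ℕ} {I : Finset ℕ} (hI : I ⊆ Finset.Icc (s + 1) (s + n))
    (hI' : ¬ I ⊆ Finset.Icc (s + 1) (s + n - 1)) : ¬ Sparse (insert (s + n + 1) I) := by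
  intro h
  obtain ⟨i, hi, hi'⟩ := Finset.not_subset.1 hI'
  have h₁ := Finset.mem_Icc.1 (hI hi)
  rw [Finset.mem_Icc] at hi'
  have := h i (Finset.mem_insert_of_mem hi) _ (Finset.mem_insert_self _ _) (by omega)
  omega

theorem sum_sparse_eq_continuant (x y : ℕ → R) (s n : ℕ) :
    ∑ I ∈ (Finset.Icc (s + 1) (s + n - 1)).powerset with Sparse I, pairMono x y s n I =
      continuant x y s n := by
  induction n using Nat.twoStepInduction with
  | zero =>
    rw [Finset.Icc_eq_empty (by omega)]
    simp [Finset.sum_filter, sparse_empty, pairMono, continuant]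
  | one =>
    rw [Finset.Icc_eq_empty (by omega)]
    simp [Finset.sum_filter, sparse_empty, pairMono, continuant]
  | more n ih₁ ih₂ =>
    rw [continuant, ← ih₁, ← ih₂]
    simp only [Finset.sum_filter]
    rw [show s + (n + 2) - 1 = s + n + 1 by omega, show s + (n + 1) - 1 = s + n by omega,
      ← Finset.insert_Icc_right_eq_Icc_add_one (by omega : s + 1 ≤ s + n + 1),
      Finset.sum_powerset_insert (by simp), Finset.mul_sum, Finset.mul_sum]
    congr 1
    · refine Finset.sum_congr rfl fun I hI => ?_
      rw [pairMono_succ x y (Finset.mem_powerset.1 hI), mul_ite, mul_zero]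
    · have hsub : (Finset.Icc (s + 1) (s + n - 1)).powerset ⊆
          (Finset.Icc (s + 1) (s + n)).powerset :=
        Finset.powerset_mono.2 (Finset.Icc_subset_Icc_right (by omega))
      rw [← Finset.sum_subset hsub]
      · refine Finset.sum_congr rfl fun I hI => ?_
        rw [Finset.mem_powerset] at hI
        simp only [sparse_insert_iff hI, pairMono_insert x y hI, mul_ite, mul_zero]
      · intro I hI hI'
        rw [Finset.mem_powerset] at hI hI'
        rw [if_neg (not_sparse_insert hI hI')]

theorem Sparse.card_le {s n : ℕ} {I : Finset ℕ} (h : Sparse I)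
    (hI : I ⊆ Finset.Icc (s + 1) (s + n - 1)) : I.card ≤ n / 2 := by
  have hdisj : Disjoint I (I.map (addRightEmbedding 1)) := by
    refine Finset.disjoint_left.2 fun i hi hi' => ?_
    obtain ⟨j, hj, rfl⟩ := Finset.mem_map.1 hi'
    have := h j hj _ hi (by simp)
    simp at this
  have hsub : I ∪ I.map (addRightEmbedding 1) ⊆ Finset.Icc (s + 1) (s + n) := by
    intro i hi
    rcases Finset.mem_union.1 hi with hi | hi
    · have := Finset.mem_Icc.1 (hI hi)
      exact Finset.mem_Icc.2 (by omega)
    · obtain ⟨j, hj, rfl⟩ := Finset.mem_map.1 hi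
      have := Finset.mem_Icc.1 (hI hj)
      exact Finset.mem_Icc.2 (by simp only [addRightEmbedding_apply]; omega)
  have := Finset.card_le_card hsub
  rw [Finset.card_union_of_disjoint hdisj, Finset.card_map, Nat.card_Icc] at this
  omega

theorem sum_C2_pairMono (x y : ℕ → R) (s n : ℕ) :
    ∑ m ∈ Finset.range (n / 2 + 1), ∑ I ∈ C2 (Finset.Icc (s + 1) (s + n - 1)) m,
      pairMono x y s n I = continuant x y s n := by
  rw [← sum_sparse_eq_continuant, ← Finset.sum_fiberwise_of_maps_to
    (g := Finset.card) (t := Finset.range (n / 2 + 1))]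
  · refine Finset.sum_congr rfl fun m _ => Finset.sum_congr ?_ fun _ _ => rfl
    ext I
    simp only [C2, Finset.mem_filter, Finset.mem_powersetCard, Finset.mem_powerset]
    exact and_right_comm
  · intro I hI
    rw [Finset.mem_filter, Finset.mem_powerset] at hI
    have := hI.2.card_le hI.1
    exact Finset.mem_range.2 (by omega)

/-- Two solutions `A`, `B` of the continuant recurrence with `A 0 = 1`, `B 0 = 0`:
their Casorati determinants are again continuants. -/
theorem casorati_succ {x y A B : ℕ → R} (hA₀ : A 0 = 1) (hB₀ : B 0 = 0)
    (hA : ∀ n, A (n + 2) = x (n + 2) * A (n + 1) + y (n + 1) * A n)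
    (hB : ∀ n, B (n + 2) = x (n + 2) * B (n + 1) + y (n + 1) * B n) (r d : ℕ) :
    A (r + d + 1) * B r - A r * B (r + d + 1) =
      (-1) ^ (r + 1) * (B 1 * ∏ p ∈ Finset.Icc 1 r, y p) * continuant x y (r + 1) d := by
  have base : ∀ r, A (r + 1) * B r - A r * B (r + 1) =
      (-1) ^ (r + 1) * (B 1 * ∏ p ∈ Finset.Icc 1 r, y p) := by
    intro r
    induction r with
    | zero => simp [hA₀, hB₀]
    | succ r ih =>
      rw [Finset.prod_Icc_succ_top (by omega), hA, hB]
      linear_combination (-y (r + 1)) * ih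
  induction d using Nat.twoStepInduction with
  | zero => simpa [continuant] using base r
  | one =>
    have := base r
    simp only [continuant, hA, hB]
    linear_combination x (r + 2) * this
  | more d ih₁ ih₂ =>
    rw [continuant, show r + (d + 2) + 1 = r + d + 1 + 2 by ring, hA, hB,
      show r + 1 + d + 2 = r + d + 1 + 2 by ring, show r + 1 + d + 1 = r + d + 1 + 1 by ring]
    rw [show r + (d + 1) + 1 = r + d + 1 + 1 by ring] at ih₂
    linear_combination x (r + d + 1 + 2) * ih₂ + y (r + d + 1 + 1) * ih₁

end Continuant

theorem alphaN_eq_continuant {k n : ℕ} (h : n ≤ k) :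
    alphaN k n = continuant (Xv k) (Yv k) 0 n := by
  rw [alphaN, dif_pos h, ← sum_C2_pairMono]
  simp [alphaComb, pMono, pairMono]

theorem betaP_add_two (k n : ℕ) :
    betaP k (n + 2) = Yv k k * continuant (Xv k) (Yv k) 1 n := by
  rw [betaP, ← sum_C2_pairMono, Finset.mul_sum]
  simp only [Finset.mul_sum, Nat.add_sub_cancel_left, one_add_one_eq_two]
  refine Finset.sum_congr rfl fun m _ => Finset.sum_congr rfl fun I _ => ?_
  simp [qMono, pairMono, mul_assoc, add_comm]

theorem betaP_recurrence (k n : ℕ) :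
    betaP k (n + 3) = Xv k (n + 2) * betaP k (n + 2) + Yv k (n + 1) * betaP k (n + 1) := by
  cases n with
  | zero =>
    rw [betaP_add_two k 1, betaP_add_two k 0]
    simp [continuant, betaP, mul_comm]
  | succ n =>
    rw [betaP_add_two k (n + 2), betaP_add_two k (n + 1), betaP_add_two k n, continuant,
      show 1 + n + 2 = n + 1 + 2 by ring, show 1 + n + 1 = n + 1 + 1 by ring]
    ring

theorem shiftP_continuant (k s n : ℕ) :
    shiftP k s (continuant (Xv k) (Yv k) 0 n) = continuant (Xv k) (Yv k) s n := by
  have hX (i : ℕ) : shiftP k s (Xv k i) = Xv k (i + s) := by simp [shiftP, Xv]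
  have hY (i : ℕ) : shiftP k s (Yv k i) = Yv k (i + s) := by simp [shiftP, Yv]
  induction n using Nat.twoStepInduction with
  | zero => simp [continuant]
  | one => simp [continuant, hX, add_comm]
  | more n ih₁ ih₂ =>
    simp only [continuant, map_add, map_mul, hX, hY, ih₁, ih₂]
    congr 3 <;> ring

/-- For every `k ≥ 1` and every `0 ≤ r ≤ k−1`, the continuant polynomials
satisfy
`α(k−1,k)·β(r+1,k) − α(r,k)·β(k,k) = (−1)^{r+1}·y_k·y_1⋯y_r·α_{r+1}(k−r−2,k)`
in `ℤ[x_1,…,x_k,y_1,…,y_k]` (with `α(−1,k) = 0`). -/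
theorem alpha_beta_identity {k : ℕ} (hk : 1 ≤ k) (r : ℕ) (hr : r ≤ k - 1) :
    alphaN k (k - 1) * betaP k (r + 1) - alphaN k r * betaP k k =
      (-1) ^ (r + 1) * (Yv k k * ∏ p ∈ Finset.Icc 1 r, Yv k p) *
        shiftP k (r + 1) (alphaZ k ((k : ℤ) - r - 2)) := by
  obtain ⟨d, rfl⟩ : ∃ d, k = r + d + 1 := ⟨k - 1 - r, by omega⟩
  cases d with
  | zero => simp [alphaZ]
  | succ d =>
    have hz : alphaZ (r + (d + 1) + 1) (((r + (d + 1) + 1 : ℕ) : ℤ) - r - 2) =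
        continuant (Xv _) (Yv _) 0 d := by
      rw [show ((r + (d + 1) + 1 : ℕ) : ℤ) - r - 2 = d by push_cast; ring, alphaZ,
        if_neg (by omega), Int.toNat_natCast, alphaN_eq_continuant (by omega)]
    rw [hz, shiftP_continuant, alphaN_eq_continuant (by omega), alphaN_eq_continuant (by omega),
      Nat.add_sub_cancel]
    have hβ : betaP (r + (d + 1) + 1) 2 = Yv _ (r + (d + 1) + 1) := by
      simp [betaP_add_two _ 0, continuant]
    rw [← hβ]
    exact casorati_succ (x := Xv _) (y := Yv _) (A := continuant (Xv _) (Yv _) 0)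
      (B := fun n => betaP _ (n + 1)) rfl rfl (fun n => by simp [continuant])
      (fun n => betaP_recurrence _ n) r d

end
end

section
/- Let K be a commutative unital ring, k ≥ 1, n > k, and ā, b̄, c̄ ∈ K^k. Set d_i := b_i·c_i for 1 ≤ i ≤ k, d̄ := (d_1,…,d_k), d := d_1⋯d_k, write n = m·k + r by Euclidean division (0 ≤ r < k), and let U(i) := U_i(π^{ā,−d̄}(k,k), d). Then det(T^k_n(ā,b̄,c̄)) = U(m)·α^{ā,−d̄}(k+r,k) − d·U(m−1)·α^{ā,−d̄}(r,k). -/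
noncomputable section

/-! ### Second order linear recurrences -/

section Recurrence

variable {R : Type*} [CommRing R]

/-- The sequence `u` satisfies the continuant recurrence with coefficients `X` and `Y`. -/
def IsContinuant (X Y : ℕ → R) (u : ℕ → R) : Prop :=
  ∀ n, u (n + 2) = X (n + 2) * u (n + 1) + Y (n + 1) * u n

/-- Solutions of the continuant recurrence are determined by their first two values. -/
theorem IsContinuant.ext {X Y u v : ℕ → R} (hu : IsContinuant X Y u) (hv : IsContinuant X Y v)
    (h0 : u 0 = v 0) (h1 : u 1 = v 1) (n : ℕ) : u n = v n := by
  induction n using Nat.twoStepInduction with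
  | zero => exact h0
  | one => exact h1
  | more n ih ih' => rw [hu, hv, ih, ih']

theorem IsContinuant.linear {X Y u v : ℕ → R} (hu : IsContinuant X Y u)
    (hv : IsContinuant X Y v) (p q : R) : IsContinuant X Y fun n => p * u n + q * v n := by
  intro n
  simp only [hu n, hv n]
  ring

/-- For periodic coefficients, solutions of the continuant recurrence can be shifted. -/
theorem IsContinuant.shift {X Y u : ℕ → R} {k : ℕ} (hX : ∀ n, X (n + k) = X n)
    (hY : ∀ n, Y (n + k) = Y n) (hu : IsContinuant X Y u) :
    IsContinuant X Y fun n => u (n + k) := by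
  intro n
  have h := hu (n + k)
  rw [show n + k + 2 = n + 2 + k by ring, show n + k + 1 = n + 1 + k by ring, hX, hY] at h
  exact h

/-- The solution of the continuant recurrence with initial values `0` and `1`. -/
def innerContinuant (X Y : ℕ → R) : ℕ → R
  | 0 => 0
  | 1 => 1
  | n + 2 => X (n + 2) * innerContinuant X Y (n + 1) + Y (n + 1) * innerContinuant X Y n

theorem isContinuant_innerContinuant (X Y : ℕ → R) : IsContinuant X Y (innerContinuant X Y) :=
  fun _ => by rw [innerContinuant]

/-- The Casoratian of the two fundamental solutions of the continuant recurrence. -/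
theorem IsContinuant.casoratian {X Y u v : ℕ → R} (hu : IsContinuant X Y u)
    (hv : IsContinuant X Y v) (hu0 : u 0 = 1) (hv0 : v 0 = 0) (hv1 : v 1 = 1) (n : ℕ) :
    u n * v (n + 1) - u (n + 1) * v n = ∏ i ∈ Finset.Icc 1 n, -Y i := by
  induction n with
  | zero => simp [hu0, hv0, hv1]
  | succ n ih =>
    rw [Finset.prod_Icc_succ_top (by omega), ← ih, hu n, hv n]
    ring

/-- Cayley–Hamilton for the period map of a continuant recurrence with periodic coefficients. -/
theorem IsContinuant.add_two_mul_period {X Y u v : ℕ → R} {k : ℕ} (hk : 1 ≤ k)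
    (hX : ∀ n, X (n + k) = X n) (hY : ∀ n, Y (n + k) = Y n)
    (hu : IsContinuant X Y u) (hv : IsContinuant X Y v)
    (hu0 : u 0 = 1) (hu1 : u 1 = X 1) (hv0 : v 0 = 0) (hv1 : v 1 = 1) (n : ℕ) :
    u (n + k + k) =
      (u k + Y k * v (k - 1)) * u (n + k) - (∏ i ∈ Finset.Icc 1 k, -Y i) * u n := by
  obtain ⟨l, rfl⟩ : ∃ l, k = l + 1 := ⟨k - 1, by omega⟩
  have hX1 : X (l + 2) = X 1 := by
    rw [show l + 2 = 1 + (l + 1) by ring, hX]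
  have key : ∀ w : ℕ → R, IsContinuant X Y w → ∀ n,
      w (n + (l + 1)) = w (l + 1) * u n + Y (l + 1) * w l * v n := by
    intro w hw
    refine (hw.shift hX hY).ext (hu.linear hv _ _) (by simp [hu0, hv0]) ?_
    simp only [hu1, hv1, show 1 + (l + 1) = l + 2 by ring, hw l, hX1]
    ring
  have hd := hu.casoratian hv hu0 hv0 hv1 l
  rw [Finset.prod_Icc_succ_top (by omega), ← hd, Nat.add_sub_cancel]
  rw [key u hu (n + (l + 1)), key v hv n, key u hu n]
  ring

end Recurrence

/-! ### Generalized Fibonacci polynomials -/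

section GenFib

variable {R : Type*} [CommRing R]

theorem genFib_succ_eq_sum_antidiagonal (x y : R) (m : ℕ) :
    genFib x y (m + 1) = ∑ p ∈ Finset.HasAntidiagonal.antidiagonal m,
      (-1 : R) ^ p.1 * (Nat.choose p.2 p.1 : R) * x ^ (p.2 - p.1) * y ^ p.1 := by
  rw [Finset.Nat.sum_antidiagonal_eq_sum_range_succ
    (fun i j => (-1 : R) ^ i * (Nat.choose j i : R) * x ^ (j - i) * y ^ i), genFib]
  refine Finset.sum_subset_zero_on_sdiff ?_ ?_ ?_
  · intro i
    simp only [Finset.mem_range]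
    omega
  · intro i hi
    simp only [Finset.mem_sdiff, Finset.mem_range] at hi
    rw [Nat.choose_eq_zero_of_lt (by omega)]
    simp
  · intro i _
    rw [show m - i - i = m - 2 * i by omega]

theorem genFib_add_two (x y : R) (m : ℕ) :
    genFib x y (m + 2) = x * genFib x y (m + 1) - y * genFib x y m := by
  cases m with
  | zero => simp [genFib]
  | succ m =>
    rw [genFib_succ_eq_sum_antidiagonal, genFib_succ_eq_sum_antidiagonal,
      genFib_succ_eq_sum_antidiagonal, Finset.Nat.antidiagonal_succ_succ',
      Finset.Nat.antidiagonal_succ]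
    simp only [Finset.sum_cons, Finset.sum_map, mul_add, Finset.mul_sum,
      Function.Embedding.prodMap, Function.Embedding.coeFn_mk, Prod.map, Nat.succ_eq_add_one,
      Function.Embedding.refl_apply, Nat.choose_succ_succ, Nat.choose_zero_succ]
    have h : ∀ p : ℕ × ℕ, ((Nat.choose p.2 (p.1 + 1) : ℕ) : R) * x ^ (p.2 - p.1) =
        (Nat.choose p.2 (p.1 + 1) : R) * (x * x ^ (p.2 - (p.1 + 1))) := by
      intro p
      rcases Nat.lt_or_ge p.2 (p.1 + 1) with hp | hp
      · simp [Nat.choose_eq_zero_of_lt hp]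
      · rw [← pow_succ', show p.2 - (p.1 + 1) + 1 = p.2 - p.1 by omega]
    have h' : ∀ p : ℕ × ℕ, (-1 : R) ^ (p.1 + 1) * (Nat.choose (p.2 + 1) (p.1 + 1) : R) *
        x ^ (p.2 + 1 - (p.1 + 1)) * y ^ (p.1 + 1) =
        x * ((-1 : R) ^ (p.1 + 1) * (Nat.choose p.2 (p.1 + 1) : R) * x ^ (p.2 - (p.1 + 1)) *
          y ^ (p.1 + 1)) -
        y * ((-1 : R) ^ p.1 * (Nat.choose p.2 p.1 : R) * x ^ (p.2 - p.1) * y ^ p.1) := by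
      intro p
      rw [Nat.choose_succ_succ, Nat.add_sub_add_right, Nat.cast_add]
      linear_combination (-1) ^ (p.1 + 1) * y ^ (p.1 + 1) * h p
    simp only [Nat.choose_succ_succ, Nat.succ_eq_add_one] at h'
    rw [Finset.sum_congr rfl fun p _ => h' p, Finset.sum_sub_distrib]
    simp only [pow_zero, Nat.choose_zero_right, Nat.cast_one, Nat.cast_zero, Nat.sub_zero]
    ring

/-- Closed form, in terms of generalized Fibonacci polynomials, of a sequence satisfying a
constant-coefficient second order recurrence. -/
theorem eq_genFib_of_recurrence {x y : R} {w : ℕ → R}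
    (hw : ∀ m, w (m + 2) = x * w (m + 1) - y * w m) (m : ℕ) :
    w (m + 1) = genFib x y (m + 1) * w 1 - y * genFib x y m * w 0 := by
  induction m using Nat.twoStepInduction with
  | zero => simp [genFib]
  | one => rw [hw, genFib_add_two]; simp [genFib]
  | more m ih ih' =>
    rw [hw, ih, ih', genFib_add_two _ _ (m + 1), genFib_add_two _ _ m]
    ring

end GenFib

/-! ### Combinatorial continuants -/

section Combinatorial

/-- The set `I` contains no two consecutive integers. -/
abbrev IsSparse (I : Finset ℕ) : Prop := ∀ i ∈ I, ∀ j ∈ I, i < j → i + 2 ≤ j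

theorem IsSparse.two_mul_card_le {lo n : ℕ} {I : Finset ℕ} (hI : IsSparse I)
    (hsub : I ⊆ Finset.Ico lo n) : 2 * I.card ≤ n + 1 - lo := by
  have hdisj : Disjoint I (I.map (addRightEmbedding 1)) := by
    rw [Finset.disjoint_left]
    intro i hi hi'
    obtain ⟨j, hj, rfl⟩ := Finset.mem_map.1 hi'
    have := hI j hj _ hi (by simp)
    simp at this
  have hle : I ∪ I.map (addRightEmbedding 1) ⊆ Finset.Ico lo (n + 1) := by
    intro i hi
    simp only [Finset.mem_union, Finset.mem_map, addRightEmbedding_apply] at hi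
    rcases hi with hi | ⟨j, hj, rfl⟩
    · have := Finset.mem_Ico.1 (hsub hi)
      simp; omega
    · have := Finset.mem_Ico.1 (hsub hj)
      simp; omega
  have := Finset.card_le_card hle
  rw [Finset.card_union_of_disjoint hdisj, Finset.card_map, Nat.card_Ico] at this
  omega

variable {R : Type*} [CommRing R]

/-- The monomial obtained from `∏ i ∈ [lo, n], X i` by replacing the pair `X i * X (i + 1)` by
`Y i` for each `i ∈ I`. -/
def sparseMono (X Y : ℕ → R) (lo n : ℕ) (I : Finset ℕ) : R :=
  (∏ i ∈ I, Y i) * ∏ j ∈ (Finset.Ico lo (n + 1)).filter (fun j => j ∉ I ∧ j - 1 ∉ I), X j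

/-- The continuant of the window `[lo, n]`, as a sum over sparse subsets. -/
def sparseSum (X Y : ℕ → R) (lo n : ℕ) : R :=
  ∑ I ∈ (Finset.Ico lo n).powerset, if IsSparse I then sparseMono X Y lo n I else 0

theorem sum_C2_eq_sparseSum (X Y : ℕ → R) (lo n b : ℕ) (hb : n + 1 - lo ≤ 2 * b + 1) :
    ∑ m ∈ Finset.range (b + 1), ∑ I ∈ C2 (Finset.Ico lo n) m, sparseMono X Y lo n I =
      sparseSum X Y lo n := by
  rw [sparseSum, ← Finset.sum_filter, ← Finset.sum_fiberwise_of_maps_to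
    (s := (Finset.Ico lo n).powerset.filter IsSparse) (t := Finset.range (b + 1))
    (g := Finset.card)]
  · refine Finset.sum_congr rfl fun m _ => Finset.sum_congr ?_ fun _ _ => rfl
    ext I
    simp only [C2, Finset.mem_filter, Finset.mem_powersetCard, Finset.mem_powerset]
    tauto
  · intro I hI
    simp only [Finset.mem_filter, Finset.mem_powerset] at hI
    have := hI.2.two_mul_card_le hI.1
    simp only [Finset.mem_range]
    omega

theorem sparseSum_of_le (X Y : ℕ → R) {lo n : ℕ} (hle : n ≤ lo) :
    sparseSum X Y lo n = ∏ j ∈ Finset.Ico lo (n + 1), X j := by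
  simp [sparseSum, sparseMono, Finset.Ico_eq_empty_of_le hle, IsSparse]

theorem sparseMono_succ {X Y : ℕ → R} {lo n : ℕ} (h : lo ≤ n + 1) {I : Finset ℕ}
    (hI : I ⊆ Finset.Ico lo n) :
    sparseMono X Y lo (n + 1) I = X (n + 1) * sparseMono X Y lo n I := by
  have h1 : n + 1 ∉ I := fun hn => by have := Finset.mem_Ico.1 (hI hn); omega
  have h2 : n ∉ I := fun hn => by have := Finset.mem_Ico.1 (hI hn); omega
  rw [sparseMono, sparseMono, ← Finset.insert_Ico_right_eq_Ico_add_one h, Finset.filter_insert,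
    if_pos ⟨h1, by simpa using h2⟩, Finset.prod_insert (by simp)]
  ring

theorem sparseMono_insert {X Y : ℕ → R} {lo n : ℕ}
    {I : Finset ℕ} (hI : I ⊆ Finset.Ico lo n) :
    sparseMono X Y lo (n + 2) (insert (n + 1) I) = Y (n + 1) * sparseMono X Y lo n I := by
  have h1 : n + 1 ∉ I := fun hn => by have := Finset.mem_Ico.1 (hI hn); omega
  rw [sparseMono, sparseMono, Finset.prod_insert h1, mul_assoc]
  congr 2
  refine Finset.prod_congr ?_ fun _ _ => rfl
  ext j
  simp only [Finset.mem_filter, Finset.mem_Ico, Finset.mem_insert, not_or]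
  constructor
  · rintro ⟨⟨h2, h3⟩, ⟨h4, h5⟩, h6, h7⟩
    exact ⟨⟨h2, by omega⟩, h5, h7⟩
  · rintro ⟨⟨h2, h3⟩, h5, h7⟩
    exact ⟨⟨h2, by omega⟩, ⟨by omega, h5⟩, by omega, h7⟩

theorem isSparse_insert_iff {lo n : ℕ} {I : Finset ℕ} (hI : I ⊆ Finset.Ico lo n) :
    IsSparse (insert (n + 1) I) ↔ IsSparse I := by
  refine ⟨fun h i hi j hj => h i (Finset.mem_insert_of_mem hi) j (Finset.mem_insert_of_mem hj),
    fun h i hi j hj hij => ?_⟩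
  rcases Finset.mem_insert.1 hi with rfl | hi <;> rcases Finset.mem_insert.1 hj with rfl | hj
  · omega
  · have := Finset.mem_Ico.1 (hI hj); omega
  · have := Finset.mem_Ico.1 (hI hi); omega
  · exact h i hi j hj hij

theorem sparseSum_add_two (X Y : ℕ → R) {lo n : ℕ} (h : lo ≤ n + 1) :
    sparseSum X Y lo (n + 2) =
      X (n + 2) * sparseSum X Y lo (n + 1) + Y (n + 1) * sparseSum X Y lo n := by
  rw [sparseSum, show n + 2 = n + 1 + 1 by rfl, ← Finset.insert_Ico_right_eq_Ico_add_one h,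
    Finset.sum_powerset_insert Finset.right_notMem_Ico]
  congr 1
  · rw [sparseSum, Finset.mul_sum]
    refine Finset.sum_congr rfl fun I hI => ?_
    rw [sparseMono_succ (by omega) (Finset.mem_powerset.1 hI), mul_ite, mul_zero]
  · rw [sparseSum, Finset.mul_sum]
    symm
    refine Finset.sum_subset_zero_on_sdiff
      (Finset.powerset_mono.2 (Finset.Ico_subset_Ico_right (by omega))) ?_ ?_
    · intro I hI
      simp only [Finset.mem_sdiff, Finset.mem_powerset] at hI
      obtain ⟨hI, hI'⟩ := hI
      refine if_neg fun hs => hI' fun i hi => ?_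
      have h1 := Finset.mem_Ico.1 (hI hi)
      have h2 := hs i (Finset.mem_insert_of_mem hi) (n + 1) (Finset.mem_insert_self _ _) h1.2
      exact Finset.mem_Ico.2 ⟨h1.1, by omega⟩
    · intro I hI
      have hI' := Finset.mem_powerset.1 hI
      rw [sparseMono_insert hI', mul_ite, mul_zero]
      simp only [isSparse_insert_iff hI']

theorem isContinuant_sparseSum_one (X Y : ℕ → R) : IsContinuant X Y (sparseSum X Y 1) :=
  fun _ => sparseSum_add_two X Y (by omega)

theorem sparseSum_two_succ (X Y : ℕ → R) (n : ℕ) :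
    sparseSum X Y 2 (n + 1) = innerContinuant X Y (n + 1) := by
  induction n using Nat.twoStepInduction with
  | zero => simp [sparseSum_of_le, innerContinuant]
  | one => simp [sparseSum_of_le, innerContinuant]
  | more n ih ih' =>
    rw [sparseSum_add_two X Y (by omega), ih, ih']
    exact (isContinuant_innerContinuant X Y (n + 1)).symm

end Combinatorial

/-! ### Continuant polynomials -/

section ContinuantPolynomials

theorem alphaComb_eq_sparseSum (k r : ℕ) : alphaComb k r = sparseSum (Xv k) (Yv k) 1 r := by
  rw [← sum_C2_eq_sparseSum (Xv k) (Yv k) 1 r (r / 2) (by omega), alphaComb]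
  have h : Finset.Icc 1 (r - 1) = Finset.Ico 1 r := by
    ext; simp only [Finset.mem_Icc, Finset.mem_Ico]; omega
  rw [h]
  rfl

theorem alphaN_eq_sparseSum (k n : ℕ) (hk : 1 ≤ k) :
    alphaN k n = sparseSum (Xv k) (Yv k) 1 n := by
  induction n using Nat.twoStepInduction with
  | zero => rw [alphaN, dif_pos (by omega), alphaComb_eq_sparseSum]
  | one => rw [alphaN, dif_pos (by omega), alphaComb_eq_sparseSum]
  | more n ih ih' =>
    rw [alphaN]
    split_ifs with h
    · exact alphaComb_eq_sparseSum k _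
    · rw [isContinuant_sparseSum_one, ← ih, ← ih']
      rfl

theorem betaP_self (k : ℕ) : betaP k k = Yv k k * innerContinuant (Xv k) (Yv k) (k - 1) := by
  match k with
  | 0 => simp [betaP, innerContinuant]
  | 1 => simp [betaP, innerContinuant]
  | r + 2 =>
    rw [betaP, show r + 2 - 1 = r + 1 by omega, ← sparseSum_two_succ,
      ← sum_C2_eq_sparseSum _ _ 2 (r + 1) (r / 2) (by omega)]
    simp only [Finset.mul_sum]
    refine Finset.sum_congr rfl fun m _ => Finset.sum_congr rfl fun I _ => ?_
    rw [qMono, sparseMono, mul_assoc]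
    rfl

theorem isContinuant_alphaN {k : ℕ} (hk : 1 ≤ k) : IsContinuant (Xv k) (Yv k) (alphaN k) := by
  intro n
  simp only [alphaN_eq_sparseSum k _ hk]
  exact isContinuant_sparseSum_one _ _ n

theorem alphaN_zero {k : ℕ} (hk : 1 ≤ k) : alphaN k 0 = 1 := by
  simp [alphaN_eq_sparseSum k _ hk, sparseSum_of_le]

theorem alphaN_one {k : ℕ} (hk : 1 ≤ k) : alphaN k 1 = Xv k 1 := by
  simp [alphaN_eq_sparseSum k _ hk, sparseSum_of_le]

/-- The continuant polynomials of type `α` satisfy a constant-coefficient recurrence along each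
residue class modulo `k`. -/
theorem alphaN_add_two_mul {k : ℕ} (hk : 1 ≤ k) (n : ℕ) :
    alphaN k (n + k + k) =
      piP k k * alphaN k (n + k) - (∏ i ∈ Finset.Icc 1 k, -Yv k i) * alphaN k n := by
  rw [piP, betaP_self]
  exact (isContinuant_alphaN hk).add_two_mul_period hk (fun n => by simp [Xv])
    (fun n => by simp [Yv]) (isContinuant_innerContinuant _ _) (alphaN_zero hk) (alphaN_one hk)
    rfl rfl n

end ContinuantPolynomials

/-! ### The determinant -/

section Determinant

variable {K : Type*} [CommRing K]

/-- Expansion of a tridiagonal determinant along the last row and column. -/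
theorem det_triToeplitz_add_two (k n : ℕ) (a b c : ZMod k → K) :
    (triToeplitz k (n + 2) a b c).det =
      a ((n + 2 : ℕ) : ZMod k) * (triToeplitz k (n + 1) a b c).det -
        b ((n + 1 : ℕ) : ZMod k) * c ((n + 1 : ℕ) : ZMod k) * (triToeplitz k n a b c).det := by
  rw [Matrix.det_succ_row _ (Fin.last (n + 1)), Fin.sum_univ_castSucc, Fin.sum_univ_castSucc,
    Finset.sum_eq_zero, zero_add]
  · have h1 : (triToeplitz k (n + 2) a b c).submatrix (Fin.last (n + 1)).succAbove
        (Fin.last (n + 1)).succAbove = triToeplitz k (n + 1) a b c := by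
      ext i j
      simp [triToeplitz]
    have h2 : ((triToeplitz k (n + 2) a b c).submatrix (Fin.last (n + 1)).succAbove
        (Fin.last n).castSucc.succAbove).det =
        b ((n + 1 : ℕ) : ZMod k) * (triToeplitz k n a b c).det := by
      rw [Matrix.det_succ_column _ (Fin.last n), Fin.sum_univ_castSucc, Finset.sum_eq_zero,
        zero_add]
      · have h3 : ((triToeplitz k (n + 2) a b c).submatrix (Fin.last (n + 1)).succAbove
            (Fin.last n).castSucc.succAbove).submatrix (Fin.last n).succAbove
            (Fin.last n).succAbove = triToeplitz k n a b c := by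
          ext i j
          have hj : (Fin.last n).castSucc.succAbove j.castSucc = j.castSucc.castSucc :=
            Fin.succAbove_of_castSucc_lt _ _ (by simp [Fin.lt_def])
          simp [triToeplitz, hj]
        rw [h3]
        have hl : (Fin.last n).castSucc.succAbove (Fin.last n) = Fin.last (n + 1) := by
          rw [Fin.succAbove_of_le_castSucc _ _ le_rfl, Fin.succ_last]
        simp [triToeplitz, hl, ← two_mul]
      · intro i _
        have hl : (Fin.last n).castSucc.succAbove (Fin.last n) = Fin.last (n + 1) := by
          rw [Fin.succAbove_of_le_castSucc _ _ le_rfl, Fin.succ_last]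
        have e1 : ¬ (i : ℕ) = n + 1 := by omega
        have e2 : ¬ n = (i : ℕ) := by omega
        have e3 : ¬ (i : ℕ) = n + 1 + 1 := by omega
        simp [triToeplitz, hl, e1, e2, e3]
    have h4 : triToeplitz k (n + 2) a b c (Fin.last (n + 1)) (Fin.last (n + 1)) =
        a ((n + 2 : ℕ) : ZMod k) := by
      simp [triToeplitz, add_assoc, one_add_one_eq_two]
    have h5 : triToeplitz k (n + 2) a b c (Fin.last (n + 1)) (Fin.last n).castSucc =
        c ((n + 1 : ℕ) : ZMod k) := by
      have : ¬ n = n + 1 + 1 := by omega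
      simp [triToeplitz, this]
    rw [h1, h2, h4, h5]
    have s1 : (-1 : K) ^ (n + 1 + n) = -1 := Odd.neg_one_pow ⟨n, by ring⟩
    have s2 : (-1 : K) ^ (n + 1 + (n + 1)) = 1 := Even.neg_one_pow ⟨n + 1, rfl⟩
    simp only [Fin.val_last, Fin.val_castSucc, s1, s2]
    ring
  · intro j _
    have e1 : ¬ n + 1 = (j : ℕ) := by omega
    have e2 : ¬ (j : ℕ) = n + 1 + 1 := by omega
    have e3 : ¬ n = (j : ℕ) := by omega
    simp [triToeplitz, e1, e2, e3]

/-- The determinant of a tridiagonal `k`-Toeplitz matrix is a continuant of type `α`. -/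
theorem det_triToeplitz_eq_aeval_alphaN {k : ℕ} (hk : 1 ≤ k) (a b c d : ZMod k → K)
    (hd : ∀ i, d i = b i * c i) (n : ℕ) :
    (triToeplitz k n a b c).det =
      MvPolynomial.aeval (Sum.elim a fun i => -d i) (alphaN k n) := by
  have hdet : IsContinuant (fun n => a (n : ZMod k)) (fun n => -d (n : ZMod k))
      fun n => (triToeplitz k n a b c).det := by
    intro n
    simp only [det_triToeplitz_add_two, hd]
    ring
  refine hdet.ext (v := fun n => MvPolynomial.aeval (Sum.elim a fun i => -d i) (alphaN k n))
    (fun n => ?_) ?_ ?_ n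
  · simp [isContinuant_alphaN hk n, Xv, Yv]
  · simp [alphaN_zero hk]
  · simp [alphaN_one hk, triToeplitz, Xv]

end Determinant

/-- **Determinant of a tridiagonal `k`-Toeplitz matrix, first formula.**
Let `K` be a commutative unital ring, `k ≥ 1`, `n > k`, and `ā, b̄, c̄ ∈ K^k`.
Set `d_i := b_i·c_i`, `d := d_1⋯d_k`, and write `n = m·k + r` by Euclidean
division. With `U(i) := U_i(π^{ā,−d̄}(k,k), d)` the generalized Fibonacci
polynomials, one has
`det(T^k_n(ā,b̄,c̄)) = U(m)·α^{ā,−d̄}(k+r,k) − d·U(m−1)·α^{ā,−d̄}(r,k)`. -/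
theorem det_triToeplitz_formula₁ {K : Type*} [CommRing K] {k n : ℕ}
    (hk : 1 ≤ k) (hkn : k < n) (a b c : ZMod k → K)
    (d : ZMod k → K) (hd : ∀ i, d i = b i * c i)
    (dtot : K) (hdtot : dtot = ∏ p ∈ Finset.Icc 1 k, d ((p : ℕ) : ZMod k))
    (m r : ℕ) (hm : m = n / k) (hr : r = n % k) :
    (triToeplitz k n a b c).det =
      genFib (MvPolynomial.aeval (Sum.elim a fun i => -d i) (piP k k)) dtot m *
          MvPolynomial.aeval (Sum.elim a fun i => -d i) (alphaN k (k + r)) -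
        dtot *
          genFib (MvPolynomial.aeval (Sum.elim a fun i => -d i) (piP k k)) dtot (m - 1) *
          MvPolynomial.aeval (Sum.elim a fun i => -d i) (alphaN k r) := by
  set φ := MvPolynomial.aeval (R := ℤ) (Sum.elim a fun i => -d i) with hφ
  have hm1 : 1 ≤ m := hm ▸ Nat.div_pos hkn.le hk
  have hn : n = m * k + r := by rw [hm, hr, Nat.div_add_mod']
  obtain ⟨l, rfl⟩ : ∃ l, m = l + 1 := ⟨m - 1, by omega⟩
  have hprod : φ (∏ i ∈ Finset.Icc 1 k, -Yv k i) = dtot := by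
    simp [hdtot, hφ, Yv]
  have hrec : ∀ j, φ (alphaN k ((j + 2) * k + r)) =
      φ (piP k k) * φ (alphaN k ((j + 1) * k + r)) - dtot * φ (alphaN k (j * k + r)) := by
    intro j
    rw [show (j + 2) * k + r = j * k + r + k + k by ring,
      show (j + 1) * k + r = j * k + r + k by ring, alphaN_add_two_mul hk, map_sub, map_mul,
      map_mul, hprod]
  have h := eq_genFib_of_recurrence (w := fun j => φ (alphaN k (j * k + r))) hrec l
  simp only [one_mul, zero_mul, zero_add] at h
  rw [det_triToeplitz_eq_aeval_alphaN hk a b c d hd, ← hφ, hn, h, Nat.add_sub_cancel]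

end
end
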